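/- One-sided density domination for a single Gaussian projection of a graph (Claim 3.3, inequality (1), measure form): Let n ≥ 2, w ≥ 1 with w ≤ n/2, and let ω, ω′ be weighted graphs on Fin n such that ω(u,v) ≥ w/n for all u ≠ v, and such that ω′ agrees with ω except on one pair {a,b} (a ≠ b), where ω′(a,b) = ω(a,b) + c for some 0 < c ≤ 1. Let ν_ω be the pushforward of the standard Gaussian measure γ_P on ℝ^P under the linear map y ↦ E_ωᵀ y ∈ ℝ^n, and similarly ν_{ω′}. Then for every measurable set S ⊆ ℝ^n, ν_ω(S) ≤ e^{1/w} · ν_{ω′}(S). -/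

import Mathlib

open MeasureTheory ProbabilityTheory Matrix

noncomputable section

abbrev Pairs (n : ℕ) := {p : Fin n × Fin n // p.1 < p.2}

instance matMeas (m n : Type*) : MeasurableSpace (Matrix m n ℝ) :=
  inferInstanceAs (MeasurableSpace (m → n → ℝ))

/-- The standard Gaussian measure on `ι → ℝ`: iid standard normal coordinates. -/
def stdGaussianPi (ι : Type*) [Fintype ι] : Measure (ι → ℝ) :=
  Measure.pi fun _ => gaussianReal 0 1

instance (ι : Type*) [Fintype ι] : IsProbabilityMeasure (stdGaussianPi ι) := by
  unfold stdGaussianPi; infer_instance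

/-- The measure on `m × ι` real matrices with iid standard normal entries. -/
def stdGaussianMatrix (m ι : Type*) [Fintype m] [Fintype ι] : Measure (Matrix m ι ℝ) :=
  (Measure.pi fun _ : m => stdGaussianPi ι : Measure (m → ι → ℝ))

/-- A weighted graph: symmetric, zero diagonal, weights in `[0,1]`. -/
def IsWeightedGraph {n : ℕ} (ω : Fin n → Fin n → ℝ) : Prop :=
  (∀ u v, ω u v = ω v u) ∧ (∀ u, ω u u = 0) ∧ ∀ u v, 0 ≤ ω u v ∧ ω u v ≤ 1

/-- Two weighted graphs are neighbors if they agree except on one pair `{a,b}`. -/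
def GraphNeighbors {n : ℕ} (ω ω' : Fin n → Fin n → ℝ) : Prop :=
  ∃ a b : Fin n, a ≠ b ∧
    ∀ u v : Fin n, ({u, v} : Finset (Fin n)) ≠ {a, b} → ω u v = ω' u v

/-- The edge matrix of a weighted graph: the row indexed by `(u,v)` (with `u < v`) is
`√(ω u v) · (e_u - e_v)ᵀ`. -/
def edgeMatrix {n : ℕ} (ω : Fin n → Fin n → ℝ) : Matrix (Pairs n) (Fin n) ℝ :=
  Matrix.of fun p x =>
    Real.sqrt (ω p.1.1 p.1.2) * (if x = p.1.1 then 1 else if x = p.1.2 then -1 else 0)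

/-- The modified weights `ω_H(u,v) = w/n + (1 - w/n)·ω(u,v)` for `u ≠ v`. -/
def modWeights {n : ℕ} (w : ℝ) (ω : Fin n → Fin n → ℝ) : Fin n → Fin n → ℝ :=
  fun u v => if u = v then 0 else w / n + (1 - w / n) * ω u v

theorem sum_pairs_of_symm {n : ℕ} (F : Fin n → Fin n → ℝ) (hF : ∀ u v, F u v = F v u)
    (hF0 : ∀ u, F u u = 0) :
    2 * ∑ p : Pairs n, F p.1.1 p.1.2 = ∑ u, ∑ v, F u v := by
  have hlt : ∑ p : Pairs n, F p.1.1 p.1.2 = ∑ u, ∑ v, if u < v then F u v else 0 := by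
    rw [← Fintype.sum_prod_type' (f := fun u v => if u < v then F u v else 0),
      ← Finset.sum_filter]
    exact (Finset.sum_subtype (Finset.univ.filter fun p : Fin n × Fin n => p.1 < p.2)
      (by simp) (fun p => F p.1 p.2)).symm
  have hgt : ∑ u, ∑ v, (if u < v then F u v else 0) = ∑ u, ∑ v, if v < u then F u v else 0 := by
    rw [Finset.sum_comm]
    simp_rw [hF]
  rw [two_mul, hlt]
  nth_rewrite 2 [hgt]
  simp_rw [← Finset.sum_add_distrib]
  refine Finset.sum_congr rfl fun u _ => Finset.sum_congr rfl fun v _ => ?_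
  rcases lt_trichotomy u v with h | rfl | h
  · simp [h, h.not_gt]
  · simp [hF0]
  · simp [h, h.not_gt]

theorem stdGaussianPi_eq_withDensity (ι : Type*) [Fintype ι] :
    stdGaussianPi ι =
      volume.withDensity fun y : ι → ℝ => ENNReal.ofReal (∏ i, gaussianPDFReal 0 1 (y i)) := by
  refine Measure.pi_eq fun s hs => ?_
  rw [withDensity_apply _ (MeasurableSet.univ_pi hs), volume_pi, Measure.restrict_pi_pi,
    ← ofReal_integral_eq_lintegral_ofReal, integral_fintype_prod_eq_prod,
    ENNReal.ofReal_prod_of_nonneg]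
  · exact Finset.prod_congr rfl fun i _ =>
      (gaussianReal_apply_eq_integral 0 one_ne_zero (s i)).symm
  · exact fun i _ => integral_nonneg fun x => gaussianPDFReal_nonneg 0 1 x
  · exact Integrable.fintype_prod fun i => (integrable_gaussianPDFReal 0 1).restrict
  · exact ae_of_all _ fun y => Finset.prod_nonneg fun i _ => gaussianPDFReal_nonneg 0 1 _

theorem prod_gaussianPDFReal_le {ι : Type*} [Fintype ι] {x y : ι → ℝ} (h : y ⬝ᵥ y ≤ x ⬝ᵥ x) :
    ∏ i, gaussianPDFReal 0 1 (x i) ≤ ∏ i, gaussianPDFReal 0 1 (y i) := by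
  have key (z : ι → ℝ) : ∏ i, gaussianPDFReal 0 1 (z i) =
      (∏ _i : ι, (Real.sqrt (2 * Real.pi))⁻¹) * Real.exp (-(z ⬝ᵥ z) / 2) := by
    simp only [gaussianPDFReal_def, Finset.prod_mul_distrib, ← Real.exp_sum, dotProduct]
    congr 2
    · simp
    · rw [neg_div, Finset.sum_div, ← Finset.sum_neg_distrib]
      refine Finset.sum_congr rfl fun i _ => ?_
      simp only [NNReal.coe_one]
      ring
  rw [key, key]
  gcongr

theorem measurable_mulVec {m κ : Type*} [Finite m] [Fintype κ] (B : Matrix m κ ℝ) :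
    Measurable fun y : κ → ℝ => B *ᵥ y :=
  (Matrix.mulVecLin B).continuous_of_finiteDimensional.measurable

theorem stdGaussianPi_le_of_expanding {ι : Type*} [Fintype ι] [DecidableEq ι]
    {A : Matrix ι ι ℝ} (hdet : A.det ≠ 0) (hA : ∀ y, y ⬝ᵥ y ≤ (A *ᵥ y) ⬝ᵥ (A *ᵥ y))
    {T : Set (ι → ℝ)} (hT : MeasurableSet T) :
    stdGaussianPi ι T ≤
      ENNReal.ofReal |A.det| * stdGaussianPi ι ((fun y => A *ᵥ y) ⁻¹' T) := by
  have hmeas := measurable_mulVec A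
  have hvol : (volume : Measure (ι → ℝ)) =
      ENNReal.ofReal |A.det| • Measure.map (fun y => A *ᵥ y) volume := by
    have h := Real.map_matrix_volume_pi_eq_smul_volume_pi hdet
    change Measure.map (fun y => A *ᵥ y) volume = _ at h
    rw [h, smul_smul, ← ENNReal.ofReal_mul (abs_nonneg _), ← abs_mul, mul_inv_cancel₀ hdet]
    simp
  have hρ : Measurable fun y : ι → ℝ => ENNReal.ofReal (∏ i, gaussianPDFReal 0 1 (y i)) := by
    have := measurable_gaussianPDFReal 0 1
    fun_prop
  rw [stdGaussianPi_eq_withDensity, withDensity_apply _ hT, withDensity_apply _ (hmeas hT)]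
  conv_lhs => rw [hvol]
  rw [Measure.restrict_smul, lintegral_smul_measure, setLIntegral_map hT hρ hmeas, smul_eq_mul]
  refine mul_le_mul_right ?_ _
  exact lintegral_mono fun y => ENNReal.ofReal_le_ofReal (prod_gaussianPDFReal_le (hA y))

theorem charFunDual_stdGaussianPi {ι : Type*} [Fintype ι] [DecidableEq ι]
    (L : StrongDual ℝ (ι → ℝ)) :
    charFunDual (stdGaussianPi ι) L =
      Complex.exp (-((∑ i, L (Pi.single i 1) ^ 2 : ℝ) : ℂ) / 2) := by
  rw [stdGaussianPi, charFunDual_pi, neg_div, Complex.ofReal_sum, Finset.sum_div,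
    ← Finset.sum_neg_distrib, Complex.exp_sum]
  refine Finset.prod_congr rfl fun i _ => ?_
  rw [charFunDual_eq_charFun_map_one]
  have hL : ⇑(L.comp (ContinuousLinearMap.single ℝ (fun _ => ℝ) i)) =
      fun x => L (Pi.single i 1) * x := by
    ext x
    have : (Pi.single i x : ι → ℝ) = x • Pi.single i 1 := by simp [← Pi.single_smul]
    simp [this, mul_comm]
  rw [hL, gaussianReal_map_const_mul, charFun_gaussianReal]
  simp

theorem charFunDual_map_mulVec_stdGaussianPi {m κ : Type*} [Fintype m] [DecidableEq m] [Fintype κ]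
    (M : Matrix m κ ℝ) (L : StrongDual ℝ (m → ℝ)) :
    charFunDual (Measure.map (fun y => M *ᵥ y) (stdGaussianPi κ)) L =
      Complex.exp (-(((fun i => L (Pi.single i 1)) ⬝ᵥ
        ((M * Mᵀ) *ᵥ fun i => L (Pi.single i 1)) : ℝ) : ℂ) / 2) := by
  classical
  have hM : (fun y => M *ᵥ y) = ⇑(Matrix.mulVecLin M).toContinuousLinearMap := rfl
  rw [hM, charFunDual_map, charFunDual_stdGaussianPi]
  have hL (z : m → ℝ) : L z = (fun i => L (Pi.single i 1)) ⬝ᵥ z := by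
    conv_lhs => rw [pi_eq_sum_univ' z, map_sum]
    simp only [dotProduct, map_smul, smul_eq_mul, mul_comm]
  congr 4
  rw [← mulVec_mulVec, dotProduct_mulVec, ← mulVec_transpose, dotProduct]
  refine Finset.sum_congr rfl fun k _ => ?_
  simp only [ContinuousLinearMap.comp_apply, LinearMap.coe_toContinuousLinearMap',
    mulVecLin_apply, mulVec_single_one, sq]
  rw [hL, dotProduct_comm]
  rfl

theorem map_mulVec_stdGaussianPi_eq {m κ κ' : Type*} [Fintype m] [Fintype κ] [Fintype κ']
    {M : Matrix m κ ℝ} {N : Matrix m κ' ℝ} (h : M * Mᵀ = N * Nᵀ) :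
    Measure.map (fun y => M *ᵥ y) (stdGaussianPi κ) =
      Measure.map (fun y => N *ᵥ y) (stdGaussianPi κ') := by
  classical
  refine Measure.ext_of_charFunDual (funext fun L => ?_)
  rw [charFunDual_map_mulVec_stdGaussianPi, charFunDual_map_mulVec_stdGaussianPi, h]

/-- Adding `c • Mh(Mh)ᵀ` to the covariance `M Mᵀ` of a centred Gaussian decreases its measure by
a factor of at most `√(1 + c |h|²)`. -/
theorem map_mulVec_stdGaussianPi_le {m κ κ' : Type*} [Fintype m] [Fintype κ] [Fintype κ']
    {M : Matrix m κ ℝ} {N : Matrix m κ' ℝ} {c : ℝ} (hc : 0 ≤ c) (h : κ → ℝ)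
    (hN : N * Nᵀ = M * Mᵀ + c • vecMulVec (M *ᵥ h) (M *ᵥ h))
    {S : Set (m → ℝ)} (hS : MeasurableSet S) :
    Measure.map (fun y => M *ᵥ y) (stdGaussianPi κ) S ≤
      ENNReal.ofReal (Real.sqrt (1 + c * (h ⬝ᵥ h))) *
        Measure.map (fun y => N *ᵥ y) (stdGaussianPi κ') S := by
  classical
  have hq : 0 ≤ h ⬝ᵥ h := Finset.sum_nonneg fun i _ => mul_self_nonneg _
  obtain ⟨q, hqd⟩ : ∃ q, q = h ⬝ᵥ h := ⟨_, rfl⟩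
  rw [← hqd] at hq ⊢
  obtain ⟨s, hs⟩ : ∃ s, s = Real.sqrt (1 + c * q) := ⟨_, rfl⟩
  have hs2 : s * s = 1 + c * q := by rw [hs]; exact Real.mul_self_sqrt (by positivity)
  have hs0 : 0 < s := by rw [hs]; positivity
  rw [← hs]
  obtain ⟨t, ht⟩ : ∃ t, t = c / (1 + s) := ⟨_, rfl⟩
  have htq : 1 + t * q = s := by rw [ht]; field_simp; linarith
  have htc : 2 * t + t * t * q = c := by
    have : 2 * t + t * t * q = t * (1 + s) := by rw [← htq]; ring
    rw [this, ht]; field_simp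
  let A : Matrix κ κ ℝ := 1 + t • vecMulVec h h
  have hAT : Aᵀ = A := by simp [A, transpose_vecMulVec]
  have hAA : A * A = 1 + c • vecMulVec h h := by
    simp only [A, mul_add, add_mul, one_mul, mul_one, smul_mul_assoc, mul_smul_comm,
      vecMulVec_mul_vecMulVec, ← hqd, ← htc]
    ext i j
    simp [vecMulVec_apply]
    ring
  have hdet : A.det = s := by
    rw [← htq, hqd]
    have := det_one_add_replicateCol_mul_replicateRow (ι := Unit) (t • h) h
    rw [← vecMulVec_eq, smul_vecMulVec] at this
    rw [this, dotProduct_smul, smul_eq_mul]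
  have hexp (y : κ → ℝ) : y ⬝ᵥ y ≤ (A *ᵥ y) ⬝ᵥ (A *ᵥ y) := by
    have : (A *ᵥ y) ⬝ᵥ (A *ᵥ y) = y ⬝ᵥ y + c * (h ⬝ᵥ y) ^ 2 := by
      rw [dotProduct_mulVec, ← mulVec_transpose, hAT, mulVec_mulVec, hAA, add_mulVec, one_mulVec,
        add_dotProduct, smul_mulVec, smul_dotProduct, vecMulVec_mulVec]
      simp
      ring_nf
      simp
    rw [this]
    have := mul_nonneg hc (sq_nonneg (h ⬝ᵥ y))
    linarith
  have hcov : N * Nᵀ = (M * A) * (M * A)ᵀ := by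
    rw [hN, transpose_mul, hAT, Matrix.mul_assoc, ← Matrix.mul_assoc A, hAA, Matrix.add_mul,
      Matrix.one_mul, Matrix.mul_add, Matrix.smul_mul, Matrix.mul_smul, vecMulVec_mul,
      mul_vecMulVec, vecMul_transpose]
  rw [map_mulVec_stdGaussianPi_eq hcov, Measure.map_apply (measurable_mulVec _) hS,
    Measure.map_apply (measurable_mulVec _) hS]
  have := stdGaussianPi_le_of_expanding (by rw [hdet]; exact hs0.ne') hexp (measurable_mulVec M hS)
  rw [hdet, abs_of_pos hs0] at this
  convert this using 3
  ext y
  simp [mulVec_mulVec]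

/-- The vector `e_u - e_v`, written as in the rows of `edgeMatrix`. -/
def edgeVec {n : ℕ} (u v : Fin n) : Fin n → ℝ :=
  fun x => if x = u then 1 else if x = v then -1 else 0

theorem edgeVec_eq_sub {n : ℕ} {u v : Fin n} (h : u ≠ v) (x : Fin n) :
    edgeVec u v x = (if x = u then 1 else 0) - if x = v then 1 else 0 := by
  unfold edgeVec
  split_ifs with h1 h2 <;> simp_all

theorem edgeMatrix_apply {n : ℕ} (ω : Fin n → Fin n → ℝ) (p : Pairs n) (x : Fin n) :
    edgeMatrix ω p x = Real.sqrt (ω p.1.1 p.1.2) * edgeVec p.1.1 p.1.2 x :=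
  rfl

theorem edgeMatrix_transpose_mul_self {n : ℕ} {ω ω' : Fin n → Fin n → ℝ}
    (hpos : ∀ u v, 0 ≤ ω u v) (hpos' : ∀ u v, 0 ≤ ω' u v) {a b : Fin n} (hab : a < b) {c : ℝ}
    (hagree : ∀ u v, ({u, v} : Finset (Fin n)) ≠ {a, b} → ω' u v = ω u v)
    (hab' : ω' a b = ω a b + c) :
    (edgeMatrix ω')ᵀ * (edgeMatrix ω')ᵀᵀ =
      (edgeMatrix ω)ᵀ * (edgeMatrix ω)ᵀᵀ + c • vecMulVec (edgeVec a b) (edgeVec a b) := by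
  ext x y
  have hentry {ω : Fin n → Fin n → ℝ} (hpos : ∀ u v, 0 ≤ ω u v) :
      ((edgeMatrix ω)ᵀ * (edgeMatrix ω)ᵀᵀ) x y =
        ∑ p : Pairs n, ω p.1.1 p.1.2 * (edgeVec p.1.1 p.1.2 x * edgeVec p.1.1 p.1.2 y) := by
    simp only [mul_apply, transpose_apply, edgeMatrix_apply]
    refine Finset.sum_congr rfl fun p _ => ?_
    rw [mul_mul_mul_comm, Real.mul_self_sqrt (hpos _ _)]
  have hω' (p : Pairs n) : ω' p.1.1 p.1.2 =
      ω p.1.1 p.1.2 + if p = ⟨(a, b), hab⟩ then c else 0 := by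
    split_ifs with h
    · subst h
      exact hab'
    · rw [add_zero]
      refine hagree _ _ fun hs => h ?_
      obtain ⟨⟨u, v⟩, huv⟩ := p
      simp only [Finset.ext_iff, Finset.mem_insert, Finset.mem_singleton] at hs huv
      have hu := (hs u).1 (Or.inl rfl)
      have hv := (hs v).1 (Or.inr rfl)
      rw [Subtype.mk.injEq, Prod.mk.injEq]
      lia
  rw [Matrix.add_apply, hentry hpos, hentry hpos']
  simp_rw [hω', add_mul, Finset.sum_add_distrib, ite_mul, zero_mul]
  simp [vecMulVec_apply]

/-- The electrical flow from `a` to `b` in the complete graph, rescaled by `√ω`. -/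
def rescaledFlow {n : ℕ} (ω : Fin n → Fin n → ℝ) (a b : Fin n) : Pairs n → ℝ :=
  fun p => (edgeVec a b p.1.1 - edgeVec a b p.1.2) / n / Real.sqrt (ω p.1.1 p.1.2)

theorem sum_edgeVec {n : ℕ} {a b : Fin n} (hab : a ≠ b) : ∑ x, edgeVec a b x = 0 := by
  simp [edgeVec_eq_sub hab]

theorem sum_edgeVec_sq {n : ℕ} {a b : Fin n} (hab : a ≠ b) : ∑ x, edgeVec a b x ^ 2 = 2 := by
  have (x : Fin n) : edgeVec a b x ^ 2 = (if x = a then 1 else 0) + if x = b then 1 else 0 := by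
    unfold edgeVec
    split_ifs with h1 h2 <;> simp_all
  simp [this, Finset.sum_add_distrib]
  norm_num

theorem edgeMatrix_transpose_mulVec_rescaledFlow {n : ℕ} {ω : Fin n → Fin n → ℝ}
    (hω : ∀ u v, u ≠ v → 0 < ω u v) {a b : Fin n} (hab : a ≠ b) :
    (edgeMatrix ω)ᵀ *ᵥ rescaledFlow ω a b = edgeVec a b := by
  have hn : (n : ℝ) ≠ 0 := by
    have := a.pos
    positivity
  ext z
  let F : Fin n → Fin n → ℝ := fun u v =>
    (edgeVec a b u - edgeVec a b v) / n * ((if z = u then 1 else 0) - if z = v then 1 else 0)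
  have hsum : ((edgeMatrix ω)ᵀ *ᵥ rescaledFlow ω a b) z = ∑ p : Pairs n, F p.1.1 p.1.2 := by
    simp only [mulVec, dotProduct, transpose_apply, edgeMatrix_apply, rescaledFlow, F]
    refine Finset.sum_congr rfl fun p _ => ?_
    have hs := (Real.sqrt_pos.2 (hω _ _ p.2.ne)).ne'
    rw [edgeVec_eq_sub p.2.ne]
    field_simp
  have h2 := sum_pairs_of_symm F (fun u v => by simp only [F]; ring) (fun u => by simp [F])
  have htot : ∑ u, ∑ v, F u v = 2 * edgeVec a b z := by
    simp only [F, mul_sub, mul_ite, mul_one, mul_zero, Finset.sum_sub_distrib]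
    rw [Finset.sum_comm]
    simp [← Finset.sum_div, Finset.sum_sub_distrib, sum_edgeVec hab]
    field_simp
    ring
  rw [hsum]
  linarith

theorem rescaledFlow_dotProduct_self_le {n : ℕ} {ω : Fin n → Fin n → ℝ} {w : ℝ} (hw : 0 < w)
    (hlb : ∀ u v, u ≠ v → w / n ≤ ω u v) {a b : Fin n} (hab : a ≠ b) :
    rescaledFlow ω a b ⬝ᵥ rescaledFlow ω a b ≤ 2 / w := by
  have hn : 0 < (n : ℝ) := by
    have := a.pos
    positivity
  let F : Fin n → Fin n → ℝ := fun u v => (edgeVec a b u - edgeVec a b v) ^ 2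
  have hle : rescaledFlow ω a b ⬝ᵥ rescaledFlow ω a b ≤
      1 / (n * w) * ∑ p : Pairs n, F p.1.1 p.1.2 := by
    rw [dotProduct, Finset.mul_sum]
    refine Finset.sum_le_sum fun p _ => ?_
    have hp := hlb _ _ p.2.ne
    have hp0 : 0 < ω p.1.1 p.1.2 := (by positivity : 0 < w / n).trans_le hp
    calc rescaledFlow ω a b p * rescaledFlow ω a b p
        = F p.1.1 p.1.2 / n ^ 2 / ω p.1.1 p.1.2 := by
          rw [rescaledFlow, div_mul_div_comm, Real.mul_self_sqrt hp0.le, div_mul_div_comm,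
            ← sq, ← sq]
      _ ≤ F p.1.1 p.1.2 / n ^ 2 / (w / n) := by gcongr
      _ = 1 / (n * w) * F p.1.1 p.1.2 := by field_simp
  have h2 := sum_pairs_of_symm F (fun u v => by simp only [F]; ring) (fun u => by simp [F])
  have htot : ∑ u, ∑ v, F u v = 4 * n := by
    simp only [F, sub_sq, Finset.sum_add_distrib, Finset.sum_sub_distrib, ← Finset.mul_sum,
      sum_edgeVec hab, sum_edgeVec_sq hab]
    simp
    rw [← Finset.mul_sum, sum_edgeVec_sq hab]
    ring
  refine hle.trans (le_of_eq ?_)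
  rw [show ∑ p : Pairs n, F p.1.1 p.1.2 = 2 * n by linarith]
  field_simp

/-- Claim 3.3, inequality (1), measure form: one-sided density domination for a single
Gaussian projection of a graph. -/
theorem gaussian_projection_domination {n : ℕ} (hn : 2 ≤ n) {w : ℝ}
    (hw1 : 1 ≤ w) (hwn : w ≤ n / 2) {ω ω' : Fin n → Fin n → ℝ}
    (hsym : ∀ u v, ω u v = ω v u) (hdiag : ∀ u, ω u u = 0) (hpos : ∀ u v, 0 ≤ ω u v)
    (hsym' : ∀ u v, ω' u v = ω' v u) (hdiag' : ∀ u, ω' u u = 0) (hpos' : ∀ u v, 0 ≤ ω' u v)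
    (hlb : ∀ u v, u ≠ v → w / n ≤ ω u v)
    {a b : Fin n} (hab : a ≠ b) {c : ℝ} (hc : 0 < c) (hc1 : c ≤ 1)
    (hagree : ∀ u v, ({u, v} : Finset (Fin n)) ≠ {a, b} → ω' u v = ω u v)
    (hab' : ω' a b = ω a b + c)
    {S : Set (Fin n → ℝ)} (hS : MeasurableSet S) :
    Measure.map (fun y : Pairs n → ℝ => (edgeMatrix ω)ᵀ *ᵥ y) (stdGaussianPi (Pairs n)) S
    ≤ ENNReal.ofReal (Real.exp (1 / w)) *
      Measure.map (fun y : Pairs n → ℝ => (edgeMatrix ω')ᵀ *ᵥ y) (stdGaussianPi (Pairs n)) S := by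

  wlog hlt : a < b generalizing a b
  · exact this hab.symm (fun u v h => hagree u v (by rwa [Finset.pair_comm a b]))
      (by rw [hsym' b a, hsym b a, hab']) (hab.lt_or_gt.resolve_left hlt)
  have hw : 0 < w := by linarith
  have hn0 : (0 : ℝ) < n := by positivity
  have hω (u v : Fin n) (h : u ≠ v) : 0 < ω u v := (div_pos hw hn0).trans_le (hlb u v h)
  have hcov := edgeMatrix_transpose_mul_self hpos hpos' hlt hagree hab'
  rw [← edgeMatrix_transpose_mulVec_rescaledFlow hω hab] at hcov
  refine (map_mulVec_stdGaussianPi_le hc.le _ hcov hS).trans ?_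
  gcongr
  have hq := rescaledFlow_dotProduct_self_le hw hlb hab
  have hq0 : 0 ≤ rescaledFlow ω a b ⬝ᵥ rescaledFlow ω a b :=
    Finset.sum_nonneg fun i _ => mul_self_nonneg _
  refine Real.sqrt_le_iff.2 ⟨(Real.exp_pos _).le, ?_⟩
  calc 1 + c * (rescaledFlow ω a b ⬝ᵥ rescaledFlow ω a b)
      ≤ 2 / w + 1 := by nlinarith
    _ ≤ Real.exp (2 / w) := Real.add_one_le_exp _
    _ = Real.exp (1 / w) ^ 2 := by rw [← Real.exp_nat_mul]; congr 1; push_cast; ring
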